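/- (Categorified product formula, distinct case) Let m > n ≥ 1. Define f := (−1)^n · (t_m ⊗ t_n) ∘ (t_{m−n} ⊗ Cu_n) : V^{⊗(m−n)} → V^{⊗(m+n)} and g := (t_{m−n} ⊗ Ca_n) ∘ (t_m ⊗ t_n) : V^{⊗(m+n)} → V^{⊗(m−n)}. Then g ∘ f = t_{m−n} and f ∘ g = e_{m,n}; i.e. f and g are mutually inverse isomorphisms between the images of the idempotents t_{m−n} and e_{m,n}. -/

import Mathlib

open Matrix

noncomputable section

/-- Sign strings `ε ∈ {+,-}^m`; `true` encodes `+` and `false` encodes `-`. -/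
abbrev Sgn (m : ℕ) := Fin m → Bool

/-- Endomorphisms of `V^{⊗m}` (`V = ℂ²`), as matrices indexed by sign strings. -/
abbrev Op (m : ℕ) := Matrix (Sgn m) (Sgn m) ℂ

/-- Linear maps `V^{⊗m} → V^{⊗n}`, as matrices (rows: target, columns: source). -/
abbrev Mor (m n : ℕ) := Matrix (Sgn n) (Sgn m) ℂ

/-- The basis vector `v_ε` of `V^{⊗m}`. -/
def bv {m : ℕ} (ε : Sgn m) : Sgn m → ℂ := fun δ => if δ = ε then 1 else 0

/-- The coefficient of `cap` on `v_a ⊗ v_b`: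
`cap (v₋ ⊗ v₊) = 1`, `cap (v₊ ⊗ v₋) = -1`, `cap (v₊ ⊗ v₊) = cap (v₋ ⊗ v₋) = 0`. -/
def capc (a b : Bool) : ℂ := if a then (if b then 0 else -1) else (if b then 1 else 0)

/-- The coefficient of `v_a ⊗ v_b` in `cup 1 = v₊ ⊗ v₋ - v₋ ⊗ v₊`. -/
def cupc (a b : Bool) : ℂ := if a then (if b then 0 else 1) else (if b then -1 else 0)

/-- The cap `V ⊗ V → ℂ`. -/
def capM : Mor 2 0 := Matrix.of fun _ ε => capc (ε 0) (ε 1)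

/-- The cup `ℂ → V ⊗ V`. -/
def cupM : Mor 0 2 := Matrix.of fun δ _ => cupc (δ 0) (δ 1)

/-- The tensor product of two linear maps. -/
def tensMor {a b c d : ℕ} (A : Mor a b) (B : Mor c d) : Mor (a + c) (b + d) :=
  Matrix.of fun δ ε =>
    A (fun i => δ (Fin.castAdd d i)) (fun i => ε (Fin.castAdd c i)) *
      B (fun j => δ (Fin.natAdd b j)) (fun j => ε (Fin.natAdd a j))

/-- The swap of the two tensor factors of `V ⊗ V`. -/
def swap2 : Op 2 := Matrix.of fun δ ε => if δ 0 = ε 1 ∧ δ 1 = ε 0 then 1 else 0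

/-- `id^{⊗p} ⊗ A ⊗ id^{⊗(m-p-2)}`: the operator `A` on two strands placed at the
(0-based) positions `p`, `p+1` among `m` strands. -/
def atPos (m p : ℕ) (A : Op 2) : Op m :=
  Matrix.of fun δ ε =>
    if h : p + 2 ≤ m then
      (if ∀ k : Fin m, k.val ≠ p → k.val ≠ p + 1 → δ k = ε k then 1 else 0) *
        A (fun i => δ ⟨p + i.val, Nat.lt_of_lt_of_le (Nat.add_lt_add_left i.isLt p) h⟩)
          (fun i => ε ⟨p + i.val, Nat.lt_of_lt_of_le (Nat.add_lt_add_left i.isLt p) h⟩)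
    else 0

/-- Cyclic rotation of sign strings: `(rotIdx δ) k = δ (k+1 mod m)`. -/
def rotIdx {m : ℕ} (δ : Sgn m) : Sgn m := fun k => δ ⟨(k.val + 1) % m, Nat.mod_lt _ k.pos⟩

/-- The rotation `d_m : V^{⊗m} → V^{⊗m}`, `d_m (v_ε ⊗ w) = i^{ε} (w ⊗ v_ε)`. -/
def dRot : (m : ℕ) → Op m
  | 0 => 1
  | (m + 1) =>
    Matrix.of fun δ' δ =>
      if δ' = rotIdx δ then (if δ 0 then Complex.I else -Complex.I) else 0

/-- The cap-cup generator `u_j` (`j` is 1-based, `1 ≤ j ≤ m-1`);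
`u_0 := d_m⁻¹ ∘ u_1 ∘ d_m` is the affine generator. -/
def uFull (m j : ℕ) : Op m :=
  if j = 0 then (dRot m)⁻¹ * atPos m 0 (cupM * capM) * dRot m
  else atPos m (j - 1) (cupM * capM)

/-- The extremal weight projectors `t_m`, defined by `t₁ = id`,
`t₂ = id + u₁/2 + u₀/2`, and `t_{m+1} = (t_m ⊗ id) ∘ σ_m ∘ (t_m ⊗ id)` for `m ≥ 2`
(with the convention `t₀ = 2·id`). -/
def tP : (m : ℕ) → Op m
  | 0 => (2 : ℂ) • 1
  | 1 => 1
  | 2 => 1 + (2⁻¹ : ℂ) • atPos 2 0 (cupM * capM) +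
      (2⁻¹ : ℂ) • ((dRot 2)⁻¹ * atPos 2 0 (cupM * capM) * dRot 2)
  | (m + 3) =>
    tensMor (tP (m + 2)) (1 : Op 1) * atPos (m + 3) (m + 1) swap2 *
      tensMor (tP (m + 2)) (1 : Op 1)

/-- `n` nested caps `Ca_n : V^{⊗2n} → ℂ`. -/
def CaM (n : ℕ) : Mor (n + n) 0 :=
  Matrix.of fun _ δ =>
    ∏ k : Fin n,
      capc (δ ⟨k.val, Nat.lt_of_lt_of_le k.isLt (Nat.le_add_right n n)⟩)
        (δ ⟨n + n - 1 - k.val,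
          Nat.lt_of_le_of_lt (Nat.sub_le _ _)
            (Nat.sub_lt (Nat.lt_of_lt_of_le k.pos (Nat.le_add_right n n)) Nat.one_pos)⟩)

/-- `n` nested cups `Cu_n : ℂ → V^{⊗2n}`. -/
def CuM (n : ℕ) : Mor 0 (n + n) :=
  Matrix.of fun δ _ =>
    ∏ k : Fin n,
      cupc (δ ⟨k.val, Nat.lt_of_lt_of_le k.isLt (Nat.le_add_right n n)⟩)
        (δ ⟨n + n - 1 - k.val,
          Nat.lt_of_le_of_lt (Nat.sub_le _ _)
            (Nat.sub_lt (Nat.lt_of_lt_of_le k.pos (Nat.le_add_right n n)) Nat.one_pos)⟩)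

/-- The canonical identification of sign strings induced by an equality of lengths. -/
def sgnCast {a b : ℕ} (h : a = b) : Sgn a ≃ Sgn b :=
  Equiv.arrowCongr (finCongr h) (Equiv.refl Bool)

/-- Reindexing of a linear map along equalities of the numbers of strands. -/
def rc {a b c d : ℕ} (h1 : a = b) (h2 : c = d) (A : Mor a c) : Mor b d :=
  Matrix.reindex (sgnCast h2) (sgnCast h1) A

/-- The idempotents `e_{m,n}`:
`e_{1,1} = -u₁/2 - d₂⁻¹ ∘ u₁ ∘ d₂ / 2` and
`e_{m,n} = -(t_m ⊗ t_n) ∘ u_m ∘ (t_m ⊗ t_n)` otherwise. -/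
def eP : (m n : ℕ) → Op (m + n)
  | 1, 1 =>
    (-(2⁻¹ : ℂ)) • atPos 2 0 (cupM * capM) +
      (-(2⁻¹ : ℂ)) • ((dRot 2)⁻¹ * atPos 2 0 (cupM * capM) * dRot 2)
  | m, n =>
    -(tensMor (tP m) (tP n) * atPos (m + n) (m - 1) (cupM * capM) * tensMor (tP m) (tP n))

/-- The sign string `a^m b^n`. -/
def blk (m n : ℕ) (a b : Bool) : Sgn (m + n) := fun i => if i.val < m then a else b

/-- The indicator of the constant sign strings. -/
def constInd {m : ℕ} (δ : Sgn m) : ℂ := by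
  classical exact if ∃ a, δ = fun _ => a then 1 else 0

theorem constInd_const {m : ℕ} (a : Bool) : constInd (fun _ : Fin m => a) = 1 := by
  unfold constInd
  exact if_pos ⟨a, rfl⟩

theorem constInd_of_not {m : ℕ} {δ : Sgn m} (h : ¬ ∃ a, δ = fun _ => a) : constInd δ = 0 := by
  unfold constInd
  exact if_neg h

theorem cup_mul_cap_apply (δ ε : Sgn 2) :
    (cupM * capM) δ ε = cupc (δ 0) (δ 1) * capc (ε 0) (ε 1) := by
  simp [Matrix.mul_apply, cupM, capM]

theorem atPos_two (A : Op 2) : atPos 2 0 A = A := by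
  ext δ ε
  have h : ∀ k : Fin 2, k.val ≠ 0 → k.val ≠ 0 + 1 → δ k = ε k := by
    intro k; omega
  simp only [atPos, Matrix.of_apply]
  rw [dif_pos (by omega), if_pos h, one_mul]
  congr 1 <;> funext i <;> congr 1 <;> ext <;> simp

theorem dRot_two_inv :
    (dRot 2)⁻¹ = Matrix.of fun (δ δ' : Sgn 2) =>
      if δ' = rotIdx δ then (if δ 0 then -Complex.I else Complex.I) else 0 := by
  apply Matrix.inv_eq_left_inv
  ext δ ε
  simp only [Matrix.mul_apply, dRot, Matrix.of_apply, ite_mul, zero_mul, Finset.sum_ite_eq',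
    Finset.mem_univ, if_true]
  by_cases h : δ = ε
  · subst h
    cases h0 : δ 0 <;> simp
  · have hne : rotIdx δ ≠ rotIdx ε := by
      intro h'
      apply h
      funext i
      have h0 := congrFun h' 0
      have h1 := congrFun h' 1
      simp only [rotIdx] at h0 h1
      fin_cases i
      · simpa using h1
      · simpa using h0
    simp [Matrix.one_apply_ne h, hne]

theorem conj_dRot_two_apply (A : Op 2) (δ ε : Sgn 2) :
    ((dRot 2)⁻¹ * A * dRot 2) δ ε =
      (if δ 0 then -Complex.I else Complex.I) * A (rotIdx δ) (rotIdx ε) *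
        (if ε 0 then Complex.I else -Complex.I) := by
  rw [dRot_two_inv]
  simp [Matrix.mul_apply, dRot]

theorem sgn_two_ext {δ ε : Sgn 2} : δ = ε ↔ δ 0 = ε 0 ∧ δ 1 = ε 1 := by
  rw [funext_iff, Fin.forall_fin_two]

theorem tP_two : tP 2 = Matrix.diagonal constInd := by
  ext δ ε
  have hc : constInd δ = if δ 0 = δ 1 then 1 else 0 := by
    unfold constInd
    congr 1
    simp [sgn_two_ext, eq_comm (a := δ 1)]
  have r0 (x : Sgn 2) : rotIdx x 0 = x 1 := rfl
  have r1 (x : Sgn 2) : rotIdx x 1 = x 0 := rfl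
  simp only [tP, atPos_two, Matrix.add_apply, Matrix.smul_apply, conj_dRot_two_apply,
    cup_mul_cap_apply, Matrix.one_apply, Matrix.diagonal_apply, sgn_two_ext, hc, r0, r1]
  cases δ 0 <;> cases δ 1 <;> cases ε 0 <;> cases ε 1 <;>
    simp [cupc, capc] <;> ring_nf

theorem tensMor_diagonal {a b : ℕ} (p : Sgn a → ℂ) (q : Sgn b → ℂ) :
    tensMor (Matrix.diagonal p) (Matrix.diagonal q) =
      Matrix.diagonal fun δ : Sgn (a + b) =>
        p (fun i => δ (Fin.castAdd b i)) * q (fun j => δ (Fin.natAdd a j)) := by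
  ext δ ε
  simp only [tensMor, Matrix.of_apply, Matrix.diagonal_apply]
  by_cases h : δ = ε
  · subst h; simp
  · rw [if_neg h]
    by_cases h1 : (fun i => δ (Fin.castAdd b i)) = fun i => ε (Fin.castAdd b i)
    · by_cases h2 : (fun j => δ (Fin.natAdd a j)) = fun j => ε (Fin.natAdd a j)
      · refine absurd ?_ h
        funext i
        exact Fin.addCases (fun i => congrFun h1 i) (fun j => congrFun h2 j) i
      · rw [if_neg h2, mul_zero]
    · rw [if_neg h1, zero_mul]

theorem tP_eq_diagonal : ∀ m : ℕ, 1 ≤ m → tP m = Matrix.diagonal constInd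
  | 0, h => absurd h (by omega)
  | 1, _ => by
    have : (constInd : Sgn 1 → ℂ) = fun _ => 1 := by
      funext δ
      have : δ = fun _ => δ 0 := by
        funext i; congr 1; exact Subsingleton.elim _ _
      rw [this, constInd_const]
    rw [this, Matrix.diagonal_one, tP]
  | 2, _ => tP_two
  | m + 3, _ => by
    rw [tP, tP_eq_diagonal (m + 2) (by omega), ← Matrix.diagonal_one, tensMor_diagonal]
    ext δ ε
    rw [Matrix.mul_diagonal, Matrix.diagonal_mul, Matrix.diagonal_apply]
    simp only [mul_one]
    by_cases hδ : ∃ a, (fun i : Fin (m + 2) => δ (Fin.castAdd 1 i)) = fun _ => a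
    swap
    · have h0 : constInd δ = 0 := constInd_of_not (by rintro ⟨a, rfl⟩; exact hδ ⟨a, rfl⟩)
      simp [constInd_of_not hδ, h0]
    by_cases hε : ∃ a, (fun i : Fin (m + 2) => ε (Fin.castAdd 1 i)) = fun _ => a
    swap
    · rw [constInd_of_not hε, mul_zero]
      split_ifs with h
      · rw [constInd_of_not]
        subst h
        rintro ⟨a, rfl⟩; exact hε ⟨a, rfl⟩
      · rfl
    obtain ⟨a, ha⟩ := hδ
    obtain ⟨b, hb⟩ := hε
    rw [ha, hb, constInd_const, constInd_const, one_mul, mul_one]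
    have ha' (k : ℕ) (hk : k < m + 2) : δ ⟨k, by omega⟩ = a := congrFun ha ⟨k, hk⟩
    have hb' (k : ℕ) (hk : k < m + 2) : ε ⟨k, by omega⟩ = b := congrFun hb ⟨k, hk⟩
    simp only [atPos, Matrix.of_apply, swap2]
    rw [dif_pos (by omega)]
    simp only [Fin.val_zero, Fin.val_one, add_zero]
    by_cases hall : δ = ε ∧ ∃ c, δ = fun _ => c
    · obtain ⟨rfl, c, rfl⟩ := hall
      simp [constInd_const]
    · have hR : (if δ = ε then constInd δ else 0) = 0 := by
        split_ifs with h
        · exact constInd_of_not fun hc => hall ⟨h, hc⟩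
        · rfl
      rw [hR]
      by_contra hne
      obtain ⟨h1, h2⟩ := mul_ne_zero_iff.mp hne
      have h1 := of_not_not fun hn => h1 (if_neg hn)
      obtain ⟨h2, h3⟩ := of_not_not fun hn => h2 (if_neg hn)
      have hab : a = b := by
        rw [← ha' 0 (by omega), ← hb' 0 (by omega)]
        exact h1 ⟨0, by omega⟩ (by simp) (by simp)
      subst hab
      have hδc : δ = fun _ => a := by
        funext ⟨k, hk⟩
        by_cases hk' : k < m + 2
        · exact ha' k hk'
        · obtain rfl : k = m + 1 + 1 := by omega
          exact h3.trans (hb' _ (by omega))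
      have hεc : ε = fun _ => a := by
        funext ⟨k, hk⟩
        by_cases hk' : k < m + 2
        · exact hb' k hk'
        · obtain rfl : k = m + 1 + 1 := by omega
          exact h2.symm.trans (ha' _ (by omega))
      exact hall ⟨hδc.trans hεc.symm, a, hδc⟩

/-- The indicator of the sign strings of the form `a^m b^n`. -/
def blkInd (m n : ℕ) (δ : Sgn (m + n)) : ℂ :=
  constInd (fun i => δ (Fin.castAdd n i)) * constInd (fun j => δ (Fin.natAdd m j))

theorem blkInd_blk (m n : ℕ) (a b : Bool) : blkInd m n (blk m n a b) = 1 := by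
  simp [blkInd, blk, constInd_const]

theorem blkInd_of_not {m n : ℕ} {δ : Sgn (m + n)} (h : ∀ a b, δ ≠ blk m n a b) :
    blkInd m n δ = 0 := by
  by_contra hne
  obtain ⟨h1, h2⟩ := mul_ne_zero_iff.mp hne
  obtain ⟨a, ha⟩ := of_not_not fun hn => h1 (constInd_of_not hn)
  obtain ⟨b, hb⟩ := of_not_not fun hn => h2 (constInd_of_not hn)
  apply h a b
  funext i
  refine Fin.addCases (fun i => ?_) (fun j => ?_) i
  · simpa [blk] using congrFun ha i
  · simpa [blk] using congrFun hb j

theorem blk_inj {m n : ℕ} (hm : 1 ≤ m) (hn : 1 ≤ n) {a b c d : Bool} :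
    blk m n a b = blk m n c d ↔ a = c ∧ b = d := by
  refine ⟨fun h => ⟨?_, ?_⟩, fun ⟨h1, h2⟩ => by rw [h1, h2]⟩
  · simpa [blk, show 0 < m by omega] using congrFun h ⟨0, by omega⟩
  · simpa [blk] using congrFun h ⟨m, by omega⟩

theorem const_inj {m : ℕ} (hm : 1 ≤ m) {a b : Bool} :
    ((fun _ => a : Sgn m) = fun _ => b) ↔ a = b :=
  ⟨fun h => congrFun h ⟨0, hm⟩, fun h => by rw [h]⟩

theorem tensMor_tP {m n : ℕ} (hm : 1 ≤ m) (hn : 1 ≤ n) :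
    tensMor (tP m) (tP n) = Matrix.diagonal (blkInd m n) := by
  rw [tP_eq_diagonal m hm, tP_eq_diagonal n hn, tensMor_diagonal]
  rfl

/-- The columns are the vectors `v_{a^m (-a)^n}`. -/
def blkCols (m n : ℕ) : Matrix (Sgn (m + n)) Bool ℂ :=
  Matrix.of fun δ a => if δ = blk m n a (!a) then 1 else 0

/-- The columns are the vectors `v_{a^m}`. -/
def constCols (m : ℕ) : Matrix (Sgn m) Bool ℂ :=
  Matrix.of fun δ a => if δ = fun _ => a then 1 else 0

theorem blkCols_transpose_mul {m n : ℕ} (hm : 1 ≤ m) (hn : 1 ≤ n) :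
    (blkCols m n)ᵀ * blkCols m n = 1 := by
  ext a b
  simp only [Matrix.mul_apply, Matrix.transpose_apply, blkCols, Matrix.of_apply, ite_mul, one_mul,
    zero_mul, Finset.sum_ite_eq', Finset.mem_univ, if_true, blk_inj hm hn,
    Matrix.one_apply]
  cases a <;> cases b <;> simp

theorem constCols_transpose_mul {m : ℕ} (hm : 1 ≤ m) :
    (constCols m)ᵀ * constCols m = 1 := by
  ext a b
  simp [Matrix.mul_apply, constCols, const_inj hm, Matrix.one_apply, eq_comm (a := b)]

theorem tP_eq_constCols {m : ℕ} (hm : 1 ≤ m) : tP m = constCols m * (constCols m)ᵀ := by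
  rw [tP_eq_diagonal m hm]
  ext δ ε
  rw [Matrix.diagonal_apply]
  simp only [Matrix.mul_apply, Matrix.transpose_apply, constCols, Matrix.of_apply,
    Fintype.sum_bool]
  by_cases h : ∃ a, δ = fun _ => a
  · obtain ⟨a, rfl⟩ := h
    rw [constInd_const]
    cases a <;> simp [const_inj hm, eq_comm (a := ε)]
  · rw [constInd_of_not h]
    simp only [not_exists] at h
    simp [h]

theorem atPos_cup_cap_blk {m n : ℕ} (hm : 2 ≤ m) (hn : 1 ≤ n) (a b c d : Bool) :
    atPos (m + n) (m - 1) (cupM * capM) (blk m n a b) (blk m n c d) =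
      if (a = c ∧ b = !a ∧ d = !c) then -1 else 0 := by
  simp only [atPos, Matrix.of_apply]
  rw [dif_pos (by omega), cup_mul_cap_apply]
  have e1 : m - 1 + 1 = m := by omega
  simp only [blk, Fin.val_zero, Fin.val_one, add_zero, e1, lt_irrefl, if_false,
    show m - 1 < m by omega, if_true]
  by_cases hac : a = c
  · subst hac
    by_cases hbd : b = !a ∧ d = !a
    · obtain ⟨rfl, rfl⟩ := hbd
      cases a <;> simp [cupc, capc]
    · rw [if_neg (fun h : a = a ∧ b = !a ∧ d = !a => hbd h.2)]
      cases a <;> cases b <;> cases d <;> simp_all [cupc, capc]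
  · rw [if_neg, zero_mul, if_neg (fun h => hac h.1)]
    intro h
    apply hac
    simpa [show 0 < m by omega] using
      h ⟨0, by omega⟩ (by simp; omega) (by simp; omega)

theorem eP_eq_blkCols {m n : ℕ} (hm : 2 ≤ m) (hn : 1 ≤ n) :
    eP m n = blkCols m n * (blkCols m n)ᵀ := by
  have he : eP m n = -(tensMor (tP m) (tP n) * atPos (m + n) (m - 1) (cupM * capM) *
      tensMor (tP m) (tP n)) := by
    unfold eP
    split
    · omega
    · rfl
  have hm' : 1 ≤ m := by omega
  rw [he, tensMor_tP hm' hn]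
  ext δ ε
  rw [Matrix.neg_apply, Matrix.mul_diagonal, Matrix.diagonal_mul]
  simp only [Matrix.mul_apply, Matrix.transpose_apply, blkCols, Matrix.of_apply,
    Fintype.sum_bool]
  by_cases hδ : ∃ a b, δ = blk m n a b
  swap
  · push Not at hδ
    simp [blkInd_of_not hδ, hδ]
  by_cases hε : ∃ a b, ε = blk m n a b
  swap
  · push Not at hε
    simp [blkInd_of_not hε, hε]
  obtain ⟨a, b, rfl⟩ := hδ
  obtain ⟨c, d, rfl⟩ := hε
  simp only [blkInd_blk, atPos_cup_cap_blk hm hn, blk_inj hm' hn]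
  cases a <;> cases b <;> cases c <;> cases d <;> simp

theorem blkInd_mul_apply {k m n : ℕ} (hm : 1 ≤ m) (hn : 1 ≤ n) (F : Bool → Bool → ℂ)
    (hF : ∀ a, F a a = 0) (G : Sgn (m + n) → Sgn k → ℂ)
    (hG : ∀ a b ε, G (blk m n a b) ε = (if (fun _ => a) = ε then 1 else 0) * F a b ^ n)
    (δ : Sgn (m + n)) (ε : Sgn k) :
    blkInd m n δ * G δ ε =
      (blkCols m n * Matrix.diagonal (fun a => F a (!a) ^ n) * (constCols k)ᵀ) δ ε := by
  rw [Matrix.mul_apply]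
  simp only [Matrix.mul_diagonal, Matrix.transpose_apply,
    blkCols, constCols, Matrix.of_apply, Fintype.sum_bool]
  by_cases hδ : ∃ a b, δ = blk m n a b
  swap
  · push Not at hδ
    simp [blkInd_of_not hδ, hδ]
  obtain ⟨a, b, rfl⟩ := hδ
  have hn0 : n ≠ 0 := by omega
  simp only [blkInd_blk, blk_inj hm hn, hG, eq_comm (b := ε)]
  cases a <;> cases b <;> simp [hF, hn0, mul_comm]

theorem prod_nested_blk {m n : ℕ} (F : Bool → Bool → ℂ) (a b : Bool)
    (h : m + n = m - n + (n + n)) :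
    (∏ k : Fin n, F (blk m n a b ⟨m - n + k.val, by omega⟩)
      (blk m n a b ⟨m - n + (n + n - 1 - k.val), by omega⟩)) = F a b ^ n := by
  rw [Finset.prod_congr rfl (g := fun _ => F a b)]
  · simp
  · intro k _
    have hk := k.isLt
    simp only [blk]
    rw [if_pos (by omega), if_neg (by omega)]

theorem tP_blk_apply {m n : ℕ} (hnm : n < m) (a b : Bool) (ε : Sgn (m - n)) :
    tP (m - n) (fun i => blk m n a b ⟨i.val, by omega⟩) ε =
      if (fun _ => a) = ε then 1 else 0 := by
  have : (fun i : Fin (m - n) => blk m n a b ⟨i.val, by omega⟩) = fun _ => a := by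
    funext i
    simp only [blk]
    rw [if_pos (by omega)]
  rw [this, tP_eq_diagonal _ (by omega), Matrix.diagonal_apply, constInd_const]

theorem tP_transpose {m : ℕ} (hm : 1 ≤ m) : (tP m)ᵀ = tP m := by
  rw [tP_eq_diagonal m hm, Matrix.diagonal_transpose]

theorem tensMor_mul_nested_cups {m n : ℕ} (hn : 1 ≤ n) (hnm : n < m) (h1 : m - n + 0 = m - n)
    (h : m - n + (n + n) = m + n) :
    tensMor (tP m) (tP n) * rc h1 h (tensMor (tP (m - n)) (CuM n)) =
      blkCols m n * Matrix.diagonal (fun a => cupc a (!a) ^ n) * (constCols (m - n))ᵀ := by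
  ext δ ε
  rw [tensMor_tP (by omega) hn, Matrix.diagonal_mul]
  refine blkInd_mul_apply (by omega) hn cupc (by intro a; cases a <;> simp [cupc])
    (rc h1 h (tensMor (tP (m - n)) (CuM n))) (fun a b ε => ?_) δ ε
  rw [← prod_nested_blk cupc a b h.symm, ← tP_blk_apply hnm a b]
  rfl

theorem nested_caps_mul_tensMor {m n : ℕ} (hn : 1 ≤ n) (hnm : n < m) (h1 : m - n + 0 = m - n)
    (h : m - n + (n + n) = m + n) :
    rc h h1 (tensMor (tP (m - n)) (CaM n)) * tensMor (tP m) (tP n) =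
      constCols (m - n) * Matrix.diagonal (fun a => capc a (!a) ^ n) * (blkCols m n)ᵀ := by
  apply Matrix.transpose_injective
  simp only [Matrix.transpose_mul, Matrix.transpose_transpose, Matrix.diagonal_transpose]
  rw [← Matrix.mul_assoc]
  ext δ ε
  rw [tensMor_tP (by omega) hn, Matrix.diagonal_transpose, Matrix.diagonal_mul]
  refine blkInd_mul_apply (by omega) hn capc (by intro a; cases a <;> simp [capc])
    (rc h h1 (tensMor (tP (m - n)) (CaM n)))ᵀ (fun a b ε => ?_) δ ε
  rw [← prod_nested_blk capc a b h.symm, ← tP_blk_apply hnm a b]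
  have hT := tP_transpose (m := m - n) (by omega)
  exact congrArg (fun x : ℂ => x * _) (congrFun (congrFun hT _) _)

theorem capc_mul_cupc_pow (n : ℕ) (a : Bool) :
    (-1 : ℂ) ^ n * (capc a (!a) ^ n * cupc a (!a) ^ n) = 1 := by
  rw [← mul_pow, ← mul_pow]
  cases a <;> simp [capc, cupc]

/-- Categorified product formula, distinct case: for `m > n ≥ 1`,
`f = (-1)^n (t_m ⊗ t_n) ∘ (t_{m-n} ⊗ Cu_n)` and `g = (t_{m-n} ⊗ Ca_n) ∘ (t_m ⊗ t_n)`
satisfy `g ∘ f = t_{m-n}` and `f ∘ g = e_{m,n}`. -/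
theorem product_formula_distinct (m n : ℕ) (hn : 1 ≤ n) (hnm : n < m) :
    ((rc (by omega) rfl (tensMor (tP (m - n)) (CaM n)) : Mor (m + n) (m - n)) *
        tensMor (tP m) (tP n)) *
      ((-1 : ℂ) ^ n •
        (tensMor (tP m) (tP n) *
          (rc rfl (by omega) (tensMor (tP (m - n)) (CuM n)) : Mor (m - n) (m + n)))) =
      tP (m - n) ∧
    ((-1 : ℂ) ^ n •
        (tensMor (tP m) (tP n) *
          (rc rfl (by omega) (tensMor (tP (m - n)) (CuM n)) : Mor (m - n) (m + n)))) *
      ((rc (by omega) rfl (tensMor (tP (m - n)) (CaM n)) : Mor (m + n) (m - n)) *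
        tensMor (tP m) (tP n)) = eP m n := by
  have hm : 1 ≤ m := by omega
  have hk : 1 ≤ m - n := by omega
  have hD : Matrix.diagonal (fun a => capc a (!a) ^ n) *
      ((-1 : ℂ) ^ n • Matrix.diagonal (fun a => cupc a (!a) ^ n)) = 1 := by
    rw [Matrix.mul_smul, Matrix.diagonal_mul_diagonal, ← Matrix.diagonal_smul,
      ← Matrix.diagonal_one]
    congr 1
    funext a
    exact capc_mul_cupc_pow n a
  have hD' := mul_eq_one_comm.mp hD
  rw [tensMor_mul_nested_cups hn hnm, nested_caps_mul_tensMor hn hnm, tP_eq_constCols hk,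
    eP_eq_blkCols (by omega) hn, ← Matrix.smul_mul, ← Matrix.mul_smul]
  generalize Matrix.diagonal (fun a => capc a (!a) ^ n) = A at hD hD' ⊢
  generalize (-1 : ℂ) ^ n • Matrix.diagonal (fun a => cupc a (!a) ^ n) = B at hD hD' ⊢
  have hW := blkCols_transpose_mul hm hn
  have hC := constCols_transpose_mul hk
  generalize blkCols m n = W at hW ⊢
  generalize constCols (m - n) = C at hC ⊢
  constructor
  · calc C * A * Wᵀ * (W * B * Cᵀ) = C * (A * ((Wᵀ * W) * B)) * Cᵀ := by
          simp only [Matrix.mul_assoc]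
      _ = C * Cᵀ := by rw [hW, Matrix.one_mul, hD, Matrix.mul_one]
  · calc W * B * Cᵀ * (C * A * Wᵀ) = W * (B * ((Cᵀ * C) * A)) * Wᵀ := by
          simp only [Matrix.mul_assoc]
      _ = W * Wᵀ := by rw [hC, Matrix.one_mul, hD', Matrix.mul_one]
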